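/- arXiv:2303.00405 — 2 statements merged into one kernel-verified Lean document; each statement's English description precedes it below -/
import Mathlib

section
/- The map φ_{𝔹^d} : ℝ^d → 𝔹^d defined by φ(x) = (x/‖x‖) · (γ(d/2, ‖x‖²/2)/Γ(d/2))^{1/d} for x ≠ 0 pushes the standard Gaussian measure on ℝ^d forward to the normalized Lebesgue (uniform) measure on the open unit ball 𝔹^d. -/
open MeasureTheory Real Set

/-- The lower incomplete gamma function `γ(t,x) = ∫₀ˣ s^{t−1} e^{−s} ds`. -/
noncomputable def lowerGamma (t x : ℝ) : ℝ := ∫ s in (0:ℝ)..x, s ^ (t - 1) * Real.exp (-s)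

section GaussianBall

open MeasureTheory.Measure Filter Topology Metric

/-- Integration in polar coordinates for the Lebesgue integral. -/
theorem lintegral_eq_lintegral_toSphere_lintegral_Ioi {E : Type*} [NormedAddCommGroup E]
    [NormedSpace ℝ E] [MeasurableSpace E] [BorelSpace E] [FiniteDimensional ℝ E] [Nontrivial E]
    (μ : Measure E) [μ.IsAddHaarMeasure] {f : E → ENNReal} (hf : Measurable f) :
    ∫⁻ x, f x ∂μ = ∫⁻ s : sphere (0 : E) 1, (∫⁻ r in Ioi (0 : ℝ),
      ENNReal.ofReal (r ^ (Module.finrank ℝ E - 1)) * f (r • (s : E))) ∂μ.toSphere := by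
  have hcompl : MeasurableSet ({0}ᶜ : Set E) := (measurableSet_singleton _).compl
  have hmp := (measurePreserving_homeomorphUnitSphereProd μ).symm
    (homeomorphUnitSphereProd E).toMeasurableEquiv
  have hr : Measurable fun r : Ioi (0 : ℝ) =>
      ENNReal.ofReal (r.1 ^ (Module.finrank ℝ E - 1)) := by fun_prop
  calc
    ∫⁻ x, f x ∂μ = ∫⁻ x in ({0}ᶜ : Set E), f x ∂μ := by rw [restrict_compl_singleton]
    _ = ∫⁻ x : ({0}ᶜ : Set E), f x ∂(μ.comap (↑)) := (lintegral_subtype_comap hcompl f).symm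
    _ = ∫⁻ p, f (p.2.1 • p.1.1)
          ∂(μ.toSphere.prod (volumeIoiPow (Module.finrank ℝ E - 1))) :=
        (hmp.lintegral_comp (hf.comp measurable_subtype_coe)).symm
    _ = ∫⁻ s : sphere (0 : E) 1, ∫⁻ r : Ioi (0 : ℝ), f (r.1 • (s : E))
          ∂(volumeIoiPow (Module.finrank ℝ E - 1)) ∂μ.toSphere :=
        lintegral_prod _ (by fun_prop)
    _ = _ := by
        refine lintegral_congr fun s => ?_
        rw [volumeIoiPow, lintegral_withDensity_eq_lintegral_mul _ hr (by fun_prop)]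
        exact lintegral_subtype_comap measurableSet_Ioi fun r : ℝ =>
          ENNReal.ofReal (r ^ (Module.finrank ℝ E - 1)) * f (r • (s : E))

/-- A radial map whose profile `R` increases from `(0, ∞)` onto `(0, 1)` transports the radial
density `g` to the uniform measure on the unit ball, as soon as the one-dimensional Jacobian
equation holds. -/
theorem map_radial_withDensity_eq_restrict_ball {E : Type*} [NormedAddCommGroup E]
    [NormedSpace ℝ E] [MeasurableSpace E] [BorelSpace E] [FiniteDimensional ℝ E] [Nontrivial E]
    (μ : Measure E) [μ.IsAddHaarMeasure] {R R' : ℝ → ℝ} {g : ℝ → ENNReal} (c : ENNReal)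
    (hT : Measurable fun x : E => (R ‖x‖ / ‖x‖) • x) (hg : Measurable fun x : E => g ‖x‖)
    (hR : ∀ r ∈ Ioi (0 : ℝ), HasDerivWithinAt R (R' r) (Ioi 0) r)
    (hmono : MonotoneOn R (Ioi 0)) (himage : R '' Ioi 0 = Ioo 0 1)
    (hjac : ∀ r ∈ Ioi (0 : ℝ), ENNReal.ofReal (r ^ (Module.finrank ℝ E - 1)) * g r =
      c * (ENNReal.ofReal (R' r) * ENNReal.ofReal (R r ^ (Module.finrank ℝ E - 1)))) :
    Measure.map (fun x : E => (R ‖x‖ / ‖x‖) • x) (μ.withDensity fun x => g ‖x‖) =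
      c • μ.restrict (ball 0 1) := by
  set n := Module.finrank ℝ E - 1
  refine Measure.ext fun A hA => ?_
  set I : E → ENNReal := A.indicator 1
  have hI : Measurable I := measurable_one.indicator hA
  have hball : MeasurableSet (ball (0 : E) 1) := measurableSet_ball
  have lhs : Measure.map (fun x : E => (R ‖x‖ / ‖x‖) • x) (μ.withDensity fun x => g ‖x‖) A =
      ∫⁻ x, g ‖x‖ * I ((R ‖x‖ / ‖x‖) • x) ∂μ := by
    rw [← lintegral_indicator_one hA, lintegral_map hI hT]
    exact lintegral_withDensity_eq_lintegral_mul _ hg (hI.comp hT)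
  have rhs : μ.restrict (ball 0 1) A = ∫⁻ x, (ball (0 : E) 1).indicator I x ∂μ := by
    rw [← lintegral_indicator_one hA, lintegral_indicator hball]
  rw [Measure.smul_apply, lhs, rhs, smul_eq_mul,
    lintegral_eq_lintegral_toSphere_lintegral_Ioi μ
      (f := fun x => g ‖x‖ * I ((R ‖x‖ / ‖x‖) • x)) (hg.mul (hI.comp hT)),
    lintegral_eq_lintegral_toSphere_lintegral_Ioi μ (hI.indicator hball),
    ← lintegral_const_mul _ (by
      refine Measurable.lintegral_prod_right' (f := fun p : sphere (0 : E) 1 × ℝ =>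
        ENNReal.ofReal (p.2 ^ n) * (ball (0 : E) 1).indicator I (p.2 • (p.1 : E))) ?_
      exact Measurable.mul (by fun_prop) ((hI.indicator hball).comp (by fun_prop)))]
  refine lintegral_congr fun s => ?_
  calc
    _ = ∫⁻ r in Ioi (0 : ℝ), c * (ENNReal.ofReal (R' r) *
          (ENNReal.ofReal (R r ^ n) * I (R r • (s : E)))) := by
        refine setLIntegral_congr_fun measurableSet_Ioi fun r hr => ?_
        have hr0 : (0 : ℝ) < r := hr
        have : ‖r • (s : E)‖ = r := by simp [norm_smul, abs_of_pos hr0]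
        simp only [this, smul_smul, div_mul_cancel₀ _ hr0.ne']
        rw [← mul_assoc, hjac r hr]
        ring
    _ = ∫⁻ r in Ioi (0 : ℝ), ENNReal.ofReal (R' r) *
          (c * (ENNReal.ofReal (R r ^ n) * I (R r • (s : E)))) := by
        simp only [mul_left_comm c]
    _ = ∫⁻ r in Ioo (0 : ℝ) 1, c * (ENNReal.ofReal (r ^ n) * I (r • (s : E))) := by
        rw [← himage, lintegral_image_eq_lintegral_deriv_mul_of_monotoneOn measurableSet_Ioi
          hR hmono fun r => c * (ENNReal.ofReal (r ^ n) * I (r • (s : E)))]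
    _ = c * ∫⁻ r in Ioo (0 : ℝ) 1, ENNReal.ofReal (r ^ n) * I (r • (s : E)) :=
        lintegral_const_mul _ (Measurable.mul (by fun_prop) (hI.comp (by fun_prop)))
    _ = _ := by
        congr 1
        have hsub : Ioo (0 : ℝ) 1 = Iio 1 ∩ Ioi 0 := by ext; simp [and_comm]
        rw [hsub, ← Measure.restrict_restrict measurableSet_Iio,
          ← lintegral_indicator measurableSet_Iio]
        refine setLIntegral_congr_fun measurableSet_Ioi fun r hr => ?_
        have hr0 : (0 : ℝ) < r := hr
        have hmem : r • (s : E) ∈ ball (0 : E) 1 ↔ r ∈ Iio (1 : ℝ) := by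
          simp [norm_smul, abs_of_pos hr0]
        by_cases h : r ∈ Iio (1 : ℝ)
        · simp [n, indicator_of_mem h, indicator_of_mem (hmem.2 h)]
        · simp [indicator_of_notMem h, indicator_of_notMem (mt hmem.1 h)]

theorem integrableOn_rpow_mul_exp_neg {t : ℝ} (ht : 0 < t) :
    IntegrableOn (fun s : ℝ => s ^ (t - 1) * exp (-s)) (Ioi 0) := by
  simpa only [mul_comm] using Real.GammaIntegral_convergent ht

theorem intervalIntegrable_rpow_mul_exp_neg {t x : ℝ} (ht : 0 < t) (hx : 0 ≤ x) :
    IntervalIntegrable (fun s : ℝ => s ^ (t - 1) * exp (-s)) volume 0 x :=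
  (intervalIntegrable_iff_integrableOn_Ioc_of_le hx).2
    ((integrableOn_rpow_mul_exp_neg ht).mono_set Ioc_subset_Ioi_self)

theorem hasDerivAt_lowerGamma {t x : ℝ} (ht : 0 < t) (hx : 0 < x) :
    HasDerivAt (lowerGamma t) (x ^ (t - 1) * exp (-x)) x := by
  have hc : ContinuousOn (fun s : ℝ => s ^ (t - 1) * exp (-s)) (Ioi 0) := by
    refine ContinuousOn.mul (fun s hs => ?_) (by fun_prop)
    exact (continuousAt_rpow_const _ _ (Or.inl (ne_of_gt hs))).continuousWithinAt
  exact intervalIntegral.integral_hasDerivAt_right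
    (intervalIntegrable_rpow_mul_exp_neg ht hx.le)
    (hc.stronglyMeasurableAtFilter isOpen_Ioi x hx) (hc.continuousAt (Ioi_mem_nhds hx))

theorem continuousOn_lowerGamma {t : ℝ} (ht : 0 < t) : ContinuousOn (lowerGamma t) (Ici 0) := by
  intro x hx
  rcases (mem_Ici.1 hx).eq_or_lt with rfl | hx
  · have h := intervalIntegral.continuousOn_primitive_interval'
      (intervalIntegrable_rpow_mul_exp_neg ht zero_le_one) left_mem_uIcc 0 left_mem_uIcc
    rw [uIcc_of_le zero_le_one] at h
    exact h.mono_of_mem_nhdsWithin (Icc_mem_nhdsGE one_pos)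
  · exact (hasDerivAt_lowerGamma ht hx).continuousAt.continuousWithinAt

theorem lowerGamma_zero_right (t : ℝ) : lowerGamma t 0 = 0 := by simp [lowerGamma]

theorem tendsto_lowerGamma_atTop {t : ℝ} (ht : 0 < t) :
    Tendsto (lowerGamma t) atTop (𝓝 (Gamma t)) := by
  have h := intervalIntegral_tendsto_integral_Ioi 0 (integrableOn_rpow_mul_exp_neg ht) tendsto_id
  simpa only [Gamma_eq_integral ht, mul_comm] using! h

theorem strictMonoOn_lowerGamma {t : ℝ} (ht : 0 < t) : StrictMonoOn (lowerGamma t) (Ici 0) := by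
  refine strictMonoOn_of_deriv_pos (convex_Ici 0) (continuousOn_lowerGamma ht) fun x hx => ?_
  rw [interior_Ici, mem_Ioi] at hx
  rw [(hasDerivAt_lowerGamma ht hx).deriv]
  positivity

theorem lowerGamma_pos {t x : ℝ} (ht : 0 < t) (hx : 0 < x) : 0 < lowerGamma t x := by
  simpa only [lowerGamma_zero_right] using
    strictMonoOn_lowerGamma ht self_mem_Ici hx.le hx

theorem lowerGamma_lt_Gamma {t x : ℝ} (ht : 0 < t) (hx : 0 ≤ x) : lowerGamma t x < Gamma t := by
  have hx1 : (0 : ℝ) ≤ x + 1 := by positivity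
  refine (strictMonoOn_lowerGamma ht hx hx1 (lt_add_one x)).trans_le ?_
  refine ge_of_tendsto (tendsto_lowerGamma_atTop ht) ?_
  filter_upwards [eventually_ge_atTop (x + 1)] with y hy
  exact (strictMonoOn_lowerGamma ht).monotoneOn hx1 (hx1.trans hy) hy

/-- The radial profile of the transport map from the standard Gaussian measure to the unit ball. -/
noncomputable def gaussianBallProfile (d : ℕ) (r : ℝ) : ℝ :=
  (lowerGamma ((d : ℝ) / 2) (r ^ 2 / 2) / Gamma ((d : ℝ) / 2)) ^ ((1 : ℝ) / d)

section Profile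

variable {d : ℕ}

theorem continuous_gaussianBallProfile (hd : 0 < d) : Continuous (gaussianBallProfile d) := by
  have ht : (0 : ℝ) < (d : ℝ) / 2 := by positivity
  refine Continuous.rpow_const (Continuous.div_const ?_ _) fun _ => Or.inr (by positivity)
  exact (continuousOn_lowerGamma ht).comp_continuous (by fun_prop) fun r =>
    mem_Ici.2 (by positivity)

theorem hasDerivAt_gaussianBallProfile (hd : 0 < d) {r : ℝ} (hr : 0 < r) :
    HasDerivAt (gaussianBallProfile d)
      ((r ^ 2 / 2) ^ ((d : ℝ) / 2 - 1) * exp (-(r ^ 2 / 2)) * r / Gamma ((d : ℝ) / 2) *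
        (1 / d) * (lowerGamma ((d : ℝ) / 2) (r ^ 2 / 2) / Gamma ((d : ℝ) / 2)) ^
          ((1 : ℝ) / d - 1)) r := by
  have ht : (0 : ℝ) < (d : ℝ) / 2 := by positivity
  have hx : 0 < r ^ 2 / 2 := by positivity
  have hsq : HasDerivAt (fun r : ℝ => r ^ 2 / 2) r r := by
    simpa using (hasDerivAt_pow 2 r).div_const 2
  exact (((hasDerivAt_lowerGamma ht hx).comp r hsq).div_const _).rpow_const
    (Or.inl (div_pos (lowerGamma_pos ht hx) (Gamma_pos_of_pos ht)).ne')

theorem monotoneOn_gaussianBallProfile (hd : 0 < d) :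
    MonotoneOn (gaussianBallProfile d) (Ioi 0) := by
  have ht : (0 : ℝ) < (d : ℝ) / 2 := by positivity
  have hG := Gamma_pos_of_pos ht
  intro a ha b hb hab
  have ha0 : (0 : ℝ) < a := ha
  have hpos : 0 < lowerGamma ((d : ℝ) / 2) (a ^ 2 / 2) := lowerGamma_pos ht (by positivity)
  refine rpow_le_rpow (by positivity) ?_ (by positivity)
  gcongr
  refine (strictMonoOn_lowerGamma ht).monotoneOn ?_ ?_ (by gcongr)
  all_goals exact mem_Ici.2 (by positivity)

theorem image_gaussianBallProfile (hd : 0 < d) : gaussianBallProfile d '' Ioi 0 = Ioo 0 1 := by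
  have ht : (0 : ℝ) < (d : ℝ) / 2 := by positivity
  have hG := Gamma_pos_of_pos ht
  have hd' : (0 : ℝ) < 1 / d := by positivity
  apply Subset.antisymm
  · rintro _ ⟨r, hr, rfl⟩
    have hr0 : (0 : ℝ) < r := hr
    have hpos : 0 < lowerGamma ((d : ℝ) / 2) (r ^ 2 / 2) := lowerGamma_pos ht (by positivity)
    exact ⟨by unfold gaussianBallProfile; positivity, rpow_lt_one (by positivity)
      ((div_lt_one hG).2 (lowerGamma_lt_Gamma ht (by positivity))) hd'⟩
  · have hcont := continuous_gaussianBallProfile hd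
    have h0 : Tendsto (gaussianBallProfile d) (𝓝[>] 0) (𝓝 0) := by
      have hzero : gaussianBallProfile d 0 = 0 := by
        simp [gaussianBallProfile, lowerGamma_zero_right, hd.ne']
      simpa only [hzero] using (hcont.tendsto 0).mono_left nhdsWithin_le_nhds
    have h1 : Tendsto (gaussianBallProfile d) atTop (𝓝 1) := by
      have hsq : Tendsto (fun r : ℝ => r ^ 2 / 2) atTop atTop :=
        (tendsto_pow_atTop two_ne_zero).atTop_div_const two_pos
      have h := (((tendsto_lowerGamma_atTop ht).comp hsq).div_const
        (Gamma ((d : ℝ) / 2))).rpow_const (p := 1 / (d : ℝ)) (Or.inr hd'.le)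
      simpa only [div_self hG.ne', one_rpow] using! h
    exact isPreconnected_Ioi.intermediate_value_Ioo (l₁ := 𝓝[>] 0) inf_le_right
      (le_principal_iff.2 (Ioi_mem_atTop 0)) hcont.continuousOn h0 h1

theorem gaussianBallProfile_jacobian (hd : 0 < d) {r : ℝ} (hr : 0 < r) :
    r ^ (d - 1) * ((2 * π) ^ (-(d : ℝ) / 2) * exp (-r ^ 2 / 2)) =
      (√π ^ d / Gamma ((d : ℝ) / 2 + 1))⁻¹ *
        (((r ^ 2 / 2) ^ ((d : ℝ) / 2 - 1) * exp (-(r ^ 2 / 2)) * r / Gamma ((d : ℝ) / 2) *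
          (1 / d) * (lowerGamma ((d : ℝ) / 2) (r ^ 2 / 2) / Gamma ((d : ℝ) / 2)) ^
            ((1 : ℝ) / d - 1)) * gaussianBallProfile d r ^ (d - 1)) := by
  have ht : (0 : ℝ) < (d : ℝ) / 2 := by positivity
  have hG := Gamma_pos_of_pos ht
  have hdr : (0 : ℝ) < d := by positivity
  have hF : 0 < lowerGamma ((d : ℝ) / 2) (r ^ 2 / 2) / Gamma ((d : ℝ) / 2) :=
    div_pos (lowerGamma_pos ht (by positivity)) hG
  have hroot : (lowerGamma ((d : ℝ) / 2) (r ^ 2 / 2) / Gamma ((d : ℝ) / 2)) ^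
      ((1 : ℝ) / d - 1) * gaussianBallProfile d r ^ (d - 1) = 1 := by
    rw [gaussianBallProfile, ← rpow_mul_natCast hF.le, ← rpow_add hF, Nat.cast_pred hd]
    convert rpow_zero _ using 2
    field_simp
    ring
  have hpi : √π ^ d = π ^ ((d : ℝ) / 2) := by
    rw [sqrt_eq_rpow, ← rpow_mul_natCast pi_pos.le]
    congr 1
    ring
  have hrd : (r ^ 2) ^ ((d : ℝ) / 2 - 1) * r = r ^ (d - 1) := by
    rw [← rpow_natCast r 2, ← rpow_mul hr.le, ← rpow_add_one hr.ne', ← rpow_natCast,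
      Nat.cast_pred hd]
    congr 1
    push_cast
    ring
  rw [mul_assoc _ _ (gaussianBallProfile d r ^ (d - 1)), hroot, mul_one, hpi,
    Gamma_add_one ht.ne', div_rpow (by positivity) two_pos.le, rpow_sub_one two_ne_zero,
    neg_div, rpow_neg (by positivity), mul_rpow two_pos.le pi_pos.le, neg_div, ← hrd]
  field_simp

end Profile

end GaussianBall

/-- The map `φ_{𝔹^d}(x) = (x/‖x‖)·(γ(d/2, ‖x‖²/2)/Γ(d/2))^{1/d}` pushes the standard
Gaussian measure on `ℝ^d` forward to the normalized Lebesgue (uniform) measure on the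
open unit ball `𝔹^d`. -/
theorem stmt6 (d : ℕ) (hd : 1 ≤ d) :
    Measure.map
      (fun x : EuclideanSpace ℝ (Fin d) =>
        ((lowerGamma ((d:ℝ)/2) (‖x‖^2 / 2) / Real.Gamma ((d:ℝ)/2)) ^ ((1:ℝ)/d) / ‖x‖) • x)
      (volume.withDensity
        (fun x : EuclideanSpace ℝ (Fin d) =>
          ENNReal.ofReal ((2 * π) ^ (-(d:ℝ)/2) * Real.exp (-‖x‖^2 / 2))))
    = (volume (Metric.ball (0 : EuclideanSpace ℝ (Fin d)) 1))⁻¹ •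
        volume.restrict (Metric.ball (0 : EuclideanSpace ℝ (Fin d)) 1) := by
  have hd0 : 0 < d := hd
  have : Nonempty (Fin d) := ⟨⟨0, hd0⟩⟩
  have hG : 0 < Gamma ((d : ℝ) / 2 + 1) := Gamma_pos_of_pos (by positivity)
  have hR := continuous_gaussianBallProfile hd0
  refine map_radial_withDensity_eq_restrict_ball volume (R := gaussianBallProfile d)
    (g := fun r => ENNReal.ofReal ((2 * π) ^ (-(d:ℝ)/2) * Real.exp (-r ^ 2 / 2))) _
    (by fun_prop) (by fun_prop)
    (fun r hr => (hasDerivAt_gaussianBallProfile hd0 hr).hasDerivWithinAt)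
    (monotoneOn_gaussianBallProfile hd0) (image_gaussianBallProfile hd0) fun r hr => ?_
  have hr0 : (0 : ℝ) < r := hr
  have hF : 0 < lowerGamma ((d : ℝ) / 2) (r ^ 2 / 2) :=
    lowerGamma_pos (by positivity) (by positivity)
  have hG' : 0 < Gamma ((d : ℝ) / 2) := Gamma_pos_of_pos (by positivity)
  rw [EuclideanSpace.volume_ball, ENNReal.ofReal_one, one_pow, one_mul, Fintype.card_fin,
    finrank_euclideanSpace_fin, ← ENNReal.ofReal_inv_of_pos (by positivity),
    ← ENNReal.ofReal_mul (by positivity), ← ENNReal.ofReal_mul (by positivity),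
    ← ENNReal.ofReal_mul (by positivity), gaussianBallProfile_jacobian hd0 hr0]
end

section
/- The map Φ_{S²} : ℝ² → S² ⊂ ℝ³ defined for x ≠ 0 by Φ(x) = ((x/‖x‖)·2e^{−‖x‖²/4}·√(1 − e^{−‖x‖²/2}), 2e^{−‖x‖²/2} − 1) pushes the standard Gaussian measure on ℝ² forward to the normalized uniform (surface) measure on the unit sphere S². -/
open MeasureTheory Real Set
open scoped ENNReal Pointwise

/-- The point of the unit sphere with longitude `θ` and height `w`. -/
noncomputable def cylindricalPoint (θ w : ℝ) : EuclideanSpace ℝ (Fin 3) :=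
  !₂[√(1 - w ^ 2) * cos θ, √(1 - w ^ 2) * sin θ, w]

lemma setLIntegral_eq_of_subset_of_forall_diff_eq_zero {α : Type*} [MeasurableSpace α]
    {μ : Measure α} {s t : Set α} {f : α → ℝ≥0∞} (hs : MeasurableSet s) (ht : MeasurableSet t)
    (hst : s ⊆ t) (hf : ∀ x ∈ t \ s, f x = 0) : ∫⁻ x in t, f x ∂μ = ∫⁻ x in s, f x ∂μ := by
  rw [← lintegral_indicator hs, ← lintegral_indicator ht]
  refine lintegral_congr fun x => ?_
  by_cases hxs : x ∈ s
  · rw [indicator_of_mem hxs, indicator_of_mem (hst hxs)]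
  · by_cases hxt : x ∈ t
    · rw [indicator_of_notMem hxs, indicator_of_mem hxt, hf x ⟨hxt, hxs⟩]
    · rw [indicator_of_notMem hxs, indicator_of_notMem hxt]

lemma cylindricalPoint_cos (θ : ℝ) {φ : ℝ} (hφ : 0 ≤ sin φ) :
    cylindricalPoint θ (cos φ) = !₂[sin φ * cos θ, sin φ * sin θ, cos φ] := by
  rw [cylindricalPoint, ← sin_sq, sqrt_sq hφ]

lemma norm_cylindricalPoint (θ : ℝ) {w : ℝ} (hw : w ^ 2 ≤ 1) : ‖cylindricalPoint θ w‖ = 1 := by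
  rw [EuclideanSpace.norm_eq, sqrt_eq_one, Fin.sum_univ_three]
  simp only [cylindricalPoint, norm_eq_abs, sq_abs, PiLp.toLp_apply, Matrix.cons_val]
  rw [mul_pow, mul_pow, sq_sqrt (by linarith)]
  linear_combination (1 - w ^ 2) * sin_sq_add_cos_sq θ

lemma measurable_toLp_vec3 {α : Type*} [MeasurableSpace α] {a b c : α → ℝ} (ha : Measurable a)
    (hb : Measurable b) (hc : Measurable c) :
    Measurable fun x => (!₂[a x, b x, c x] : EuclideanSpace ℝ (Fin 3)) := by
  refine (MeasurableEquiv.toLp 2 (Fin 3 → ℝ)).measurable.comp (measurable_pi_iff.2 fun i => ?_)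
  fin_cases i
  exacts [ha, hb, hc]

lemma measurable_toLp_vec2 {α : Type*} [MeasurableSpace α] {a b : α → ℝ} (ha : Measurable a)
    (hb : Measurable b) :
    Measurable fun x => (!₂[a x, b x] : EuclideanSpace ℝ (Fin 2)) := by
  refine (MeasurableEquiv.toLp 2 (Fin 2 → ℝ)).measurable.comp (measurable_pi_iff.2 fun i => ?_)
  fin_cases i
  exacts [ha, hb]

lemma lintegral_eq_polar (f : ℝ × ℝ → ℝ≥0∞) (hf : Measurable f) :
    ∫⁻ p, f p = ∫⁻ θ in Ioo (-π) π, ∫⁻ r in Ioi (0 : ℝ),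
      ENNReal.ofReal r * f (r * cos θ, r * sin θ) := by
  rw [← lintegral_comp_polarCoord_symm]
  change ∫⁻ p in Ioi (0 : ℝ) ×ˢ Ioo (-π) π, ENNReal.ofReal p.1 * f (p.1 * cos p.2, p.1 * sin p.2)
    = _
  rw [Measure.volume_eq_prod, ← Measure.prod_restrict, lintegral_prod_symm' _ (by fun_prop)]

lemma lintegral_euclideanSpace_two (f : EuclideanSpace ℝ (Fin 2) → ℝ≥0∞) :
    ∫⁻ x, f x = ∫⁻ p : ℝ × ℝ, f !₂[p.1, p.2] := by
  have h := (PiLp.volume_preserving_toLp (Fin 2)).comp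
    (volume_preserving_finTwoArrow ℝ).symm
  rw [← h.lintegral_comp_emb ((MeasurableEquiv.toLp 2 (Fin 2 → ℝ)).measurableEmbedding.comp
    (MeasurableEquiv.measurableEmbedding _))]
  rfl

lemma lintegral_euclideanSpace_three (f : EuclideanSpace ℝ (Fin 3) → ℝ≥0∞) (hf : Measurable f) :
    ∫⁻ x, f x = ∫⁻ z : ℝ, ∫⁻ p : ℝ × ℝ, f !₂[p.1, p.2, z] := by
  have h := (PiLp.volume_preserving_toLp (Fin 3)).comp
    ((volume_preserving_piFinSuccAbove (fun _ : Fin 3 => ℝ) 2).symm.comp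
      ((MeasurePreserving.id (volume : Measure ℝ)).prod (volume_preserving_finTwoArrow ℝ).symm))
  have hm : Measurable fun q : ℝ × ℝ × ℝ => f !₂[q.2.1, q.2.2, q.1] :=
    hf.comp (measurable_toLp_vec3 (by fun_prop) (by fun_prop) (by fun_prop))
  rw [← h.lintegral_comp hf]
  refine Eq.trans (lintegral_congr fun q => ?_) (lintegral_prod _ hm.aemeasurable)
  simp only [Function.comp_apply]
  congr 2
  ext i
  fin_cases i <;> rfl

/-- Spherical coordinates on `ℝ³`. -/
lemma lintegral_eq_spherical (f : EuclideanSpace ℝ (Fin 3) → ℝ≥0∞) (hf : Measurable f) :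
    ∫⁻ x, f x = ∫⁻ θ in Ioo (-π) π, ∫⁻ φ in Ioo (-π) π, ∫⁻ s in Ioi (0 : ℝ),
      ENNReal.ofReal s * (ENNReal.ofReal (s * sin φ) *
        f !₂[s * sin φ * cos θ, s * sin φ * sin θ, s * cos φ]) := by
  rw [lintegral_euclideanSpace_three f hf]
  have hm : ∀ {α : Type} [MeasurableSpace α] {a b c : α → ℝ}, Measurable a → Measurable b →
      Measurable c → Measurable fun x => f !₂[a x, b x, c x] :=
    fun ha hb hc => hf.comp (measurable_toLp_vec3 ha hb hc)
  have h1 (z : ℝ) : ∫⁻ p : ℝ × ℝ, f !₂[p.1, p.2, z] = ∫⁻ θ in Ioo (-π) π, ∫⁻ r : ℝ,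
      ENNReal.ofReal r * f !₂[r * cos θ, r * sin θ, z] := by
    rw [lintegral_eq_polar _ (hm (by fun_prop) (by fun_prop) (by fun_prop))]
    refine lintegral_congr fun θ => ?_
    conv_rhs => rw [← setLIntegral_univ]
    rw [setLIntegral_eq_of_subset_of_forall_diff_eq_zero measurableSet_Ioi
      MeasurableSet.univ (subset_univ (Ioi 0))]
    intro r hr
    rw [ENNReal.ofReal_of_nonpos (by simpa using hr.2), zero_mul]
  simp_rw [h1]
  rw [lintegral_lintegral_swap]
  · refine lintegral_congr fun θ => ?_
    have h2 : Measurable fun q : ℝ × ℝ =>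
        ENNReal.ofReal q.2 * f !₂[q.2 * cos θ, q.2 * sin θ, q.1] :=
      Measurable.mul (by fun_prop) (hm (by fun_prop) (by fun_prop) (by fun_prop))
    rw [← lintegral_prod (fun q : ℝ × ℝ =>
      ENNReal.ofReal q.2 * f !₂[q.2 * cos θ, q.2 * sin θ, q.1]) h2.aemeasurable,
      ← Measure.volume_eq_prod, lintegral_eq_polar _ h2]
  · refine (Measurable.lintegral_prod_right' (f := fun q : (ℝ × ℝ) × ℝ =>
      ENNReal.ofReal q.2 * f !₂[q.2 * cos q.1.2, q.2 * sin q.1.2, q.1.1]) ?_).aemeasurable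
    exact Measurable.mul (by fun_prop) (hm (by fun_prop) (by fun_prop) (by fun_prop))

lemma sin_mul_lintegral_eq (g : ℝ → ℝ≥0∞) :
    ∫⁻ φ in Ioo (-π) π, ENNReal.ofReal (sin φ) * g (cos φ) = ∫⁻ w in Ioo (-1) 1, g w := by
  have him : cos '' Ioo 0 π = Ioo (-1) 1 := by
    ext w
    constructor
    · rintro ⟨φ, hφ, rfl⟩
      have h1 := strictAntiOn_cos (left_mem_Icc.2 pi_pos.le) ⟨hφ.1.le, hφ.2.le⟩ hφ.1
      have h2 := strictAntiOn_cos ⟨hφ.1.le, hφ.2.le⟩ (right_mem_Icc.2 pi_pos.le) hφ.2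
      rw [cos_zero] at h1
      rw [cos_pi] at h2
      exact ⟨h2, h1⟩
    · rintro ⟨h1, h2⟩
      exact ⟨arccos w, ⟨arccos_pos.2 h2, arccos_lt_pi.2 h1⟩, cos_arccos h1.le h2.le⟩
  rw [← him, lintegral_image_eq_lintegral_abs_deriv_mul measurableSet_Ioo
    (fun φ _ => (hasDerivAt_cos φ).hasDerivWithinAt)
    (injOn_cos.mono Ioo_subset_Icc_self)]
  rw [setLIntegral_eq_of_subset_of_forall_diff_eq_zero measurableSet_Ioo
    measurableSet_Ioo (Ioo_subset_Ioo_left (by linarith [pi_pos]) : Ioo 0 π ⊆ Ioo (-π) π)]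
  · refine setLIntegral_congr_fun measurableSet_Ioo fun φ hφ => ?_
    simp only [abs_neg, abs_of_pos (sin_pos_of_mem_Ioo hφ)]
  · rintro φ ⟨hφ, hφ'⟩
    have : φ ≤ 0 := not_lt.1 fun h => hφ' ⟨h, hφ.2⟩
    rw [ENNReal.ofReal_of_nonpos (sin_nonpos_of_nonpos_of_neg_pi_le this hφ.1.le), zero_mul]

lemma lintegral_Ioo_sq : ∫⁻ s in Ioo (0 : ℝ) 1, ENNReal.ofReal (s ^ 2) = 3⁻¹ := by
  rw [restrict_Ioo_eq_restrict_Ioc, ← ofReal_integral_eq_lintegral_ofReal,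
    ← intervalIntegral.integral_of_le zero_le_one, integral_pow]
  · rw [← ENNReal.ofReal_ofNat 3, ← ENNReal.ofReal_inv_of_pos (by norm_num)]
    norm_num
  · exact (continuous_pow 2).integrableOn_Ioc
  · exact Filter.Eventually.of_forall fun s => sq_nonneg s

lemma toSphere_map_val_apply (s : Set (EuclideanSpace ℝ (Fin 3))) (hs : MeasurableSet s) :
    Measure.map Subtype.val (volume : Measure (EuclideanSpace ℝ (Fin 3))).toSphere s =
      ∫⁻ θ in Ioo (-π) π, ∫⁻ w in Ioo (-1) 1, s.indicator 1 (cylindricalPoint θ w) := by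
  rw [Measure.map_apply measurable_subtype_coe hs,
    Measure.toSphere_apply' _ (measurable_subtype_coe hs), finrank_euclideanSpace_fin]
  set T : Set (EuclideanSpace ℝ (Fin 3)) := {x | x ≠ 0 ∧ ‖x‖ < 1 ∧ ‖x‖⁻¹ • x ∈ s} with hT
  have hTm : MeasurableSet T := by
    refine (measurableSet_singleton 0).compl.inter (MeasurableSet.inter ?_ ?_)
    · exact measurableSet_lt measurable_norm measurable_const
    · exact (show Measurable fun x : EuclideanSpace ℝ (Fin 3) => ‖x‖⁻¹ • x by fun_prop) hs
  have hset : (Ioo (0 : ℝ) 1 • (Subtype.val '' ((Subtype.val : Metric.sphere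
      (0 : EuclideanSpace ℝ (Fin 3)) 1 → _) ⁻¹' s))) = T := by
    ext x
    rw [mem_smul, hT, mem_ofPred_eq]
    constructor
    · rintro ⟨r, hr, _, ⟨y, hy, rfl⟩, rfl⟩
      have hy1 : ‖(y : EuclideanSpace ℝ (Fin 3))‖ = 1 := norm_eq_of_mem_sphere y
      have hn : ‖r • (y : EuclideanSpace ℝ (Fin 3))‖ = r := by
        rw [norm_smul, hy1, mul_one, norm_of_nonneg hr.1.le]
      refine ⟨?_, by rw [hn]; exact hr.2, ?_⟩
      · rw [← norm_pos_iff, hn]; exact hr.1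
      · rwa [hn, smul_smul, inv_mul_cancel₀ hr.1.ne', one_smul]
    · rintro ⟨h0, h1, h2⟩
      refine ⟨‖x‖, ⟨norm_pos_iff.2 h0, h1⟩, ‖x‖⁻¹ • x, ⟨⟨‖x‖⁻¹ • x, ?_⟩, h2, rfl⟩, ?_⟩
      · rw [mem_sphere_zero_iff_norm, norm_smul, norm_inv, norm_norm,
          inv_mul_cancel₀ (norm_ne_zero_iff.2 h0)]
      · rw [smul_smul, mul_inv_cancel₀ (norm_ne_zero_iff.2 h0), one_smul]
  rw [hset, ← lintegral_indicator_one hTm, lintegral_eq_spherical _ (measurable_one.indicator hTm)]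
  have key (θ : ℝ) : ∫⁻ φ in Ioo (-π) π, ∫⁻ r in Ioi (0 : ℝ),
      ENNReal.ofReal r * (ENNReal.ofReal (r * sin φ) * T.indicator 1
        !₂[r * sin φ * cos θ, r * sin φ * sin θ, r * cos φ]) =
      3⁻¹ * ∫⁻ w in Ioo (-1) 1, s.indicator 1 (cylindricalPoint θ w) := by
    rw [← sin_mul_lintegral_eq, ← lintegral_const_mul' _ _ (by norm_num)]
    refine setLIntegral_congr_fun measurableSet_Ioo fun φ hφ => ?_
    rcases le_or_gt (sin φ) 0 with hs0 | hs0
    · rw [ENNReal.ofReal_of_nonpos hs0, zero_mul, mul_zero]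
      refine setLIntegral_eq_zero measurableSet_Ioi fun r hr => ?_
      simp only [Pi.zero_apply]
      rw [ENNReal.ofReal_of_nonpos (mul_nonpos_of_nonneg_of_nonpos (le_of_lt hr) hs0), zero_mul,
        mul_zero]
    · have hn : ‖cylindricalPoint θ (cos φ)‖ = 1 := norm_cylindricalPoint θ (cos_sq_le_one φ)
      have hx (r : ℝ) : !₂[r * sin φ * cos θ, r * sin φ * sin θ, r * cos φ] =
          r • cylindricalPoint θ (cos φ) := by
        rw [cylindricalPoint_cos θ hs0.le]
        ext i
        fin_cases i <;> simp [mul_assoc]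
      have hxn {r : ℝ} (hr : 0 < r) : ‖r • cylindricalPoint θ (cos φ)‖ = r := by
        rw [norm_smul, hn, mul_one, norm_of_nonneg hr.le]
      simp_rw [hx]
      rw [← lintegral_Ioo_sq, mul_comm, ← lintegral_const_mul _ (by fun_prop),
        setLIntegral_eq_of_subset_of_forall_diff_eq_zero measurableSet_Ioo measurableSet_Ioi
          (Ioo_subset_Ioi_self : Ioo (0 : ℝ) 1 ⊆ _)]
      · refine setLIntegral_congr_fun measurableSet_Ioo fun r hr => ?_
        have hmem : r • cylindricalPoint θ (cos φ) ∈ T ↔ cylindricalPoint θ (cos φ) ∈ s := by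
          rw [hT, mem_ofPred_eq, hxn hr.1, smul_smul, inv_mul_cancel₀ hr.1.ne', one_smul,
            ← norm_pos_iff, hxn hr.1]
          exact ⟨fun h => h.2.2, fun h => ⟨hr.1, hr.2, h⟩⟩
        have hind : T.indicator (1 : EuclideanSpace ℝ (Fin 3) → ℝ≥0∞)
            (r • cylindricalPoint θ (cos φ)) = s.indicator 1 (cylindricalPoint θ (cos φ)) := by
          by_cases h : cylindricalPoint θ (cos φ) ∈ s
          · rw [indicator_of_mem h, indicator_of_mem (hmem.2 h), Pi.one_apply, Pi.one_apply]
          · rw [indicator_of_notMem h, indicator_of_notMem (mt hmem.1 h)]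
        rw [hind, ENNReal.ofReal_mul hr.1.le, ENNReal.ofReal_pow hr.1.le]
        ring
      · rintro r ⟨hr, hr'⟩
        rw [indicator_of_notMem, mul_zero, mul_zero]
        rintro ⟨-, h, -⟩
        exact hr' ⟨hr, hxn hr ▸ h⟩
  simp_rw [key]
  rw [lintegral_const_mul' _ _ (by norm_num), ← mul_assoc]
  norm_num
  rw [ENNReal.mul_inv_cancel (by norm_num) (by norm_num), one_mul]

lemma exp_sq_lintegral_eq (g : ℝ → ℝ≥0∞) :
    ∫⁻ r in Ioi (0 : ℝ), ENNReal.ofReal (r * exp (-r ^ 2 / 2)) * g (2 * exp (-r ^ 2 / 2) - 1) =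
      2⁻¹ * ∫⁻ w in Ioo (-1) 1, g w := by
  have him : (fun r : ℝ => 2 * exp (-r ^ 2 / 2) - 1) '' Ioi 0 = Ioo (-1) 1 := by
    ext w
    constructor
    · rintro ⟨r, hr, rfl⟩
      have h1 : exp (-r ^ 2 / 2) < 1 := exp_lt_one_iff.2 (by linarith [pow_pos (mem_Ioi.1 hr) 2])
      have h2 := exp_pos (-r ^ 2 / 2)
      constructor <;> simp only <;> linarith
    · rintro ⟨h1, h2⟩
      have hlog : log ((w + 1) / 2) < 0 := log_neg (by linarith) (by linarith)
      refine ⟨√(-2 * log ((w + 1) / 2)), sqrt_pos.2 (by linarith), ?_⟩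
      simp only
      rw [sq_sqrt (by linarith), show -(-2 * log ((w + 1) / 2)) / 2 = log ((w + 1) / 2) by ring,
        exp_log (by linarith)]
      ring
  have hd (r : ℝ) : HasDerivAt (fun r : ℝ => 2 * exp (-r ^ 2 / 2) - 1)
      (-2 * (r * exp (-r ^ 2 / 2))) r := by
    have h := ((((hasDerivAt_pow 2 r).neg.div_const 2).exp).const_mul 2).sub_const 1
    refine h.congr_deriv ?_
    simp only [Pi.neg_apply]
    push_cast
    ring
  have hinj : InjOn (fun r : ℝ => 2 * exp (-r ^ 2 / 2) - 1) (Ioi 0) := by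
    intro a ha b hb hab
    have h : exp (-a ^ 2 / 2) = exp (-b ^ 2 / 2) := by simp only at hab; linarith
    have h' := exp_injective h
    exact (sq_eq_sq₀ (le_of_lt ha) (le_of_lt hb)).1 (by linarith)
  rw [← him, lintegral_image_eq_lintegral_abs_deriv_mul measurableSet_Ioi
    (fun r _ => (hd r).hasDerivWithinAt) hinj, ← lintegral_const_mul' _ _ (by norm_num)]
  refine setLIntegral_congr_fun measurableSet_Ioi fun r hr => ?_
  have hpos : 0 < r * exp (-r ^ 2 / 2) := mul_pos hr (exp_pos _)
  rw [abs_mul, abs_of_pos hpos, abs_neg, abs_two, ENNReal.ofReal_mul zero_le_two,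
    ENNReal.ofReal_ofNat, ← mul_assoc, ← mul_assoc, ENNReal.inv_mul_cancel (by norm_num)
    (by norm_num), one_mul]

/-- The map `Φ_{S²}(x) = ((x/‖x‖)·2e^{−‖x‖²/4}·√(1 − e^{−‖x‖²/2}), 2e^{−‖x‖²/2} − 1)`
pushes the standard Gaussian measure on `ℝ²` forward to the normalized uniform surface
measure on the unit sphere `S² ⊂ ℝ³` (viewed in the ambient space `ℝ³` via the
inclusion of the sphere). -/
theorem stmt8 :
    Measure.map
      (fun x : EuclideanSpace ℝ (Fin 2) =>
        ((WithLp.equiv 2 (Fin 3 → ℝ)).symm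
          ![2 * Real.exp (-‖x‖^2 / 4) * Real.sqrt (1 - Real.exp (-‖x‖^2 / 2)) * (x 0 / ‖x‖),
            2 * Real.exp (-‖x‖^2 / 4) * Real.sqrt (1 - Real.exp (-‖x‖^2 / 2)) * (x 1 / ‖x‖),
            2 * Real.exp (-‖x‖^2 / 2) - 1] : EuclideanSpace ℝ (Fin 3)))
      (volume.withDensity
        (fun x : EuclideanSpace ℝ (Fin 2) =>
          ENNReal.ofReal ((1 / (2 * π)) * Real.exp (-‖x‖^2 / 2))))
    = Measure.map (Subtype.val)
        (((volume : Measure (EuclideanSpace ℝ (Fin 3))).toSphere Set.univ)⁻¹ •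
          (volume : Measure (EuclideanSpace ℝ (Fin 3))).toSphere) := by
  set Φ := fun x : EuclideanSpace ℝ (Fin 2) =>
    ((WithLp.equiv 2 (Fin 3 → ℝ)).symm
      ![2 * Real.exp (-‖x‖^2 / 4) * Real.sqrt (1 - Real.exp (-‖x‖^2 / 2)) * (x 0 / ‖x‖),
        2 * Real.exp (-‖x‖^2 / 4) * Real.sqrt (1 - Real.exp (-‖x‖^2 / 2)) * (x 1 / ‖x‖),
        2 * Real.exp (-‖x‖^2 / 2) - 1] : EuclideanSpace ℝ (Fin 3)) with hΦ
  have hΦm : Measurable Φ :=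
    measurable_toLp_vec3 (by fun_prop) (by fun_prop) (by fun_prop)
  have huniv : (volume : Measure (EuclideanSpace ℝ (Fin 3))).toSphere univ =
      ENNReal.ofReal (4 * π) := by
    have h := toSphere_map_val_apply univ MeasurableSet.univ
    rw [Measure.map_apply measurable_subtype_coe MeasurableSet.univ, preimage_univ] at h
    rw [h]
    simp only [indicator_univ, Pi.one_apply, lintegral_const, Measure.restrict_apply_univ,
      Real.volume_Ioo, one_mul]
    rw [← ENNReal.ofReal_mul (by norm_num)]
    ring_nf
  ext s hs
  rw [Measure.map_smul, Measure.smul_apply, toSphere_map_val_apply s hs, huniv, smul_eq_mul,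
    Measure.map_apply hΦm hs, withDensity_apply _ (hΦm hs), ← lintegral_indicator (hΦm hs),
    lintegral_euclideanSpace_two, lintegral_eq_polar, ← lintegral_const_mul']
  · refine lintegral_congr fun θ => ?_
    have hc : (ENNReal.ofReal (4 * π))⁻¹ = ENNReal.ofReal (1 / (2 * π)) * 2⁻¹ := by
      rw [← ENNReal.ofReal_inv_of_pos (by positivity), ← ENNReal.ofReal_ofNat 2,
        ← ENNReal.ofReal_inv_of_pos two_pos, ← ENNReal.ofReal_mul (by positivity)]
      congr 1
      field_simp
      norm_num
    rw [hc, mul_assoc, ← exp_sq_lintegral_eq, ← lintegral_const_mul' _ _ ENNReal.ofReal_ne_top]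
    refine setLIntegral_congr_fun measurableSet_Ioi fun r hr => ?_
    have hr : 0 < r := hr
    have hn : ‖(!₂[r * cos θ, r * sin θ] : EuclideanSpace ℝ (Fin 2))‖ = r := by
      rw [EuclideanSpace.norm_eq, Fin.sum_univ_two]
      simp only [norm_eq_abs, sq_abs, Matrix.cons_val]
      rw [show (r * cos θ) ^ 2 + (r * sin θ) ^ 2 = r ^ 2 by
        linear_combination r ^ 2 * sin_sq_add_cos_sq θ, sqrt_sq hr.le]
    have hsq : √(1 - (2 * exp (-r ^ 2 / 2) - 1) ^ 2) =
        2 * exp (-r ^ 2 / 4) * √(1 - exp (-r ^ 2 / 2)) := by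
      have he : exp (-r ^ 2 / 2) = exp (-r ^ 2 / 4) ^ 2 := by
        rw [← exp_nat_mul]
        ring_nf
      rw [show 1 - (2 * exp (-r ^ 2 / 2) - 1) ^ 2 =
        (2 * exp (-r ^ 2 / 4)) ^ 2 * (1 - exp (-r ^ 2 / 2)) by rw [he]; ring,
        sqrt_mul (sq_nonneg _), sqrt_sq (by positivity)]
    have hpt : Φ !₂[r * cos θ, r * sin θ] = cylindricalPoint θ (2 * exp (-r ^ 2 / 2) - 1) := by
      simp only [hΦ, cylindricalPoint, hn, hsq]
      ext i
      fin_cases i <;> simp [hr.ne']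
    by_cases hmem : cylindricalPoint θ (2 * exp (-r ^ 2 / 2) - 1) ∈ s
    · have hmem' : !₂[r * cos θ, r * sin θ] ∈ Φ ⁻¹' s := by rwa [mem_preimage, hpt]
      rw [indicator_of_mem hmem, indicator_of_mem hmem', hn, Pi.one_apply, mul_one,
        ← ENNReal.ofReal_mul hr.le, ← ENNReal.ofReal_mul (by positivity)]
      ring_nf
    · have hmem' : !₂[r * cos θ, r * sin θ] ∉ Φ ⁻¹' s := by rwa [mem_preimage, hpt]
      rw [indicator_of_notMem hmem, indicator_of_notMem hmem', mul_zero, mul_zero, mul_zero]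
  · simp [pi_pos]
  · refine Measurable.comp (g := (Φ ⁻¹' s).indicator _) (Measurable.indicator ?_ (hΦm hs))
      (measurable_toLp_vec2 (by fun_prop) (by fun_prop))
    fun_prop
end
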